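/- Second entropy lemma from the Z-interference-channel impossibility argument (Example 2). Let U₀, U₁, U₂, V₀, V₁, V₂ be jointly distributed finite-valued random variables and let X₁, X₂ be {0,1}-valued random variables on the same space such that: H(X₁ | U₀, U₁) = 0; H(X₂ | U₀, V₀, U₂, V₂) = 0; H(X₁ ⊕ X₂ | V₀, V₁, V₂) = 0 (⊕ denoting addition mod 2); I(U₀, U₁, U₂; V₀, V₁, V₂) = 0; and I(U₁; U₂ | U₀) = 0. Then H(X₁ | U₀) = 0. -/

import Mathlib

open MeasureTheory

/-- Shannon entropy (in bits) of a finite-valued random variable `X` on `(Ω, μ)`: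
`H(X) = −Σ_a P(X = a) · log₂ P(X = a)` (with the convention `0 · log₂ 0 = 0`). -/
noncomputable def entH {Ω : Type*} [MeasurableSpace Ω] {α : Type*} [Fintype α]
    (μ : Measure Ω) (X : Ω → α) : ℝ :=
  -∑ a : α, (μ (X ⁻¹' {a})).toReal * Real.logb 2 (μ (X ⁻¹' {a})).toReal

/-- Conditional entropy `H(X | Y) = H(X, Y) − H(Y)`. -/
noncomputable def condEntH {Ω : Type*} [MeasurableSpace Ω] {α β : Type*} [Fintype α] [Fintype β]
    (μ : Measure Ω) (X : Ω → α) (Y : Ω → β) : ℝ :=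
  entH μ (fun ω => (X ω, Y ω)) - entH μ Y

/-- Mutual information `I(X; Y) = H(X) + H(Y) − H(X, Y)`. -/
noncomputable def miH {Ω : Type*} [MeasurableSpace Ω] {α β : Type*} [Fintype α] [Fintype β]
    (μ : Measure Ω) (X : Ω → α) (Y : Ω → β) : ℝ :=
  entH μ X + entH μ Y - entH μ (fun ω => (X ω, Y ω))

/-- Conditional mutual information `I(X; Y | Z) = H(X|Z) + H(Y|Z) − H(X,Y|Z)`. -/
noncomputable def cmiH {Ω : Type*} [MeasurableSpace Ω] {α β γ : Type*}
    [Fintype α] [Fintype β] [Fintype γ]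
    (μ : Measure Ω) (X : Ω → α) (Y : Ω → β) (Z : Ω → γ) : ℝ :=
  condEntH μ X Z + condEntH μ Y Z - condEntH μ (fun ω => (X ω, Y ω)) Z

section FiniteEntropy

variable {Ω : Type*} [MeasurableSpace Ω] {μ : Measure Ω} {α β γ : Type*}

theorem measureReal_preimage_singleton_le_comp [IsFiniteMeasure μ] (W : Ω → α) (g : α → β)
    (a : α) : μ.real (W ⁻¹' {a}) ≤ μ.real ((fun ω => g (W ω)) ⁻¹' {g a}) := by
  refine measureReal_mono fun ω hω => ?_
  simp only [Set.mem_preimage, Set.mem_singleton_iff] at hω ⊢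
  rw [hω]

theorem ae_measureReal_preimage_singleton_ne_zero [IsFiniteMeasure μ] [Finite α] (W : Ω → α) :
    ∀ᵐ ω ∂μ, μ.real (W ⁻¹' {W ω}) ≠ 0 := by
  have h : ∀ᵐ ω ∂μ, ∀ a, μ.real (W ⁻¹' {a}) = 0 → W ω ≠ a := by
    refine ae_all_iff.2 fun a => ?_
    by_cases ha : μ.real (W ⁻¹' {a}) = 0
    · have h0 : μ (W ⁻¹' {a}) = 0 := (measureReal_eq_zero_iff).1 ha
      filter_upwards [measure_eq_zero_iff_ae_notMem.1 h0] with ω hω _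
      simpa using hω
    · exact Filter.Eventually.of_forall fun _ h => absurd h ha
  filter_upwards [h] with ω hω h0
  exact hω _ h0 rfl

theorem exists_mem_of_ae_of_measureReal_ne_zero {s : Set Ω} {P : Ω → Prop}
    (hs : μ.real s ≠ 0) (hP : ∀ᵐ ω ∂μ, P ω) : ∃ ω ∈ s, P ω := by
  by_contra! h
  refine hs ?_
  have h0 : μ s = 0 := measure_mono_null (fun ω hω => h ω hω) (ae_iff.1 hP)
  simp [Measure.real, h0]

theorem entH_prodMk_unit [Fintype α] (μ : Measure Ω) (X : Ω → α) :
    entH μ (fun ω => (X ω, ())) = entH μ X := by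
  have hpre : ∀ a, (fun ω => (X ω, ())) ⁻¹' {(a, ())} = X ⁻¹' {a} := by
    intro a
    ext ω
    simp
  simp [entH, Fintype.sum_prod_type, hpre]

theorem miH_eq_cmiH_unit [Fintype α] [Fintype β] [IsProbabilityMeasure μ] (X : Ω → α) (Y : Ω → β) :
    miH μ X Y = cmiH μ X Y fun _ => () := by
  have hconst : entH μ (fun _ => ()) = 0 := by simp [entH]
  simp only [miH, cmiH, condEntH, entH_prodMk_unit, hconst, sub_zero]

/-- The tangent-line bound behind Gibbs' inequality. -/
theorem sub_le_mul_log_sub_log {p q : ℝ} (hp : 0 ≤ p) (hq : 0 ≤ q) (hpq : p ≠ 0 → q ≠ 0) :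
    p - q ≤ p * (Real.log p - Real.log q) := by
  rcases hp.eq_or_lt with rfl | hp
  · simpa using hq
  · have hq' : 0 < q := hq.lt_of_ne' (hpq hp.ne')
    have h := mul_le_mul_of_nonneg_left (Real.log_le_sub_one_of_pos (div_pos hq' hp)) hp.le
    rw [Real.log_div hq'.ne' hp.ne', mul_sub _ _ (1 : ℝ),
      mul_div_cancel₀ _ hp.ne', mul_one] at h
    linarith

/-- In the equality case of Gibbs' inequality the first measure dominates the second. -/
theorem eq_zero_of_sum_mul_log_sub_log_eq_zero {ι : Type*} [Fintype ι] {p q : ι → ℝ}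
    (hp : ∀ i, 0 ≤ p i) (hq : ∀ i, 0 ≤ q i) (hpq : ∀ i, p i ≠ 0 → q i ≠ 0)
    (hsum : ∑ i, p i = ∑ i, q i) (h : ∑ i, p i * (Real.log (p i) - Real.log (q i)) = 0)
    {i : ι} (hi : p i = 0) : q i = 0 := by
  have hle := fun i (_ : i ∈ Finset.univ) => sub_le_mul_log_sub_log (hp i) (hq i) (hpq i)
  have heq := (Finset.sum_eq_sum_iff_of_le hle).1
    (by rw [h, Finset.sum_sub_distrib, hsum, sub_self]) i (Finset.mem_univ i)
  simpa [hi] using heq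

variable [MeasurableSpace α] [MeasurableSingletonClass α]

/-- The law of a function of a finite-valued random variable. -/
theorem measureReal_comp_preimage_singleton [IsFiniteMeasure μ] [Fintype α] [DecidableEq β]
    {W : Ω → α} (hW : Measurable W) (g : α → β) (b : β) :
    μ.real ((fun ω => g (W ω)) ⁻¹' {b}) = ∑ a with g a = b, μ.real (W ⁻¹' {a}) := by
  rw [sum_measureReal_preimage_singleton _ fun a _ => hW (measurableSet_singleton a)]
  congr 1
  ext ω
  simp

/-- The entropy of `g ∘ W` as an expectation over the law of `W`. -/
theorem entH_comp [IsFiniteMeasure μ] [Fintype α] [Fintype β] {W : Ω → α} (hW : Measurable W)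
    (g : α → β) :
    entH μ (fun ω => g (W ω)) =
      -∑ a, μ.real (W ⁻¹' {a}) * Real.logb 2 (μ.real ((fun ω => g (W ω)) ⁻¹' {g a})) := by
  classical
  unfold entH
  rw [← Finset.sum_fiberwise Finset.univ g]
  congr 1
  refine Finset.sum_congr rfl fun b _ => ?_
  change μ.real _ * Real.logb 2 (μ.real _) = _
  conv_lhs => rw [measureReal_comp_preimage_singleton hW g b, Finset.sum_mul]
  refine Finset.sum_congr rfl fun a ha => ?_
  rw [← (Finset.mem_filter.1 ha).2, measureReal_comp_preimage_singleton hW g (g a)]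

variable [Fintype α] [MeasurableSpace β] [MeasurableSingletonClass β] [Fintype β]
  [MeasurableSpace γ] [MeasurableSingletonClass γ] [Fintype γ]

theorem condEntH_eq_sum [IsFiniteMeasure μ] {X : Ω → α} {Y : Ω → β} (hX : Measurable X)
    (hY : Measurable Y) :
    condEntH μ X Y = ∑ a : α × β, μ.real ((fun ω => (X ω, Y ω)) ⁻¹' {a}) *
      (Real.logb 2 (μ.real (Y ⁻¹' {a.2})) -
        Real.logb 2 (μ.real ((fun ω => (X ω, Y ω)) ⁻¹' {a}))) := by
  have hW := hX.prodMk hY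
  have h := entH_comp (μ := μ) hW Prod.snd
  simp only at h
  unfold condEntH
  rw [h]
  simp only [entH, mul_sub, Finset.sum_sub_distrib, Measure.real]
  ring

/-- Vanishing conditional entropy forces `X` to be almost surely a function of `Y`. -/
theorem exists_ae_eq_of_condEntH_eq_zero [IsProbabilityMeasure μ] {X : Ω → α} {Y : Ω → β}
    (hX : Measurable X) (hY : Measurable Y) (h : condEntH μ X Y = 0) :
    ∃ f : β → α, ∀ᵐ ω ∂μ, X ω = f (Y ω) := by
  classical
  have hW := hX.prodMk hY
  set p : α × β → ℝ := fun a => μ.real ((fun ω => (X ω, Y ω)) ⁻¹' {a}) with hp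
  set q : β → ℝ := fun b => μ.real (Y ⁻¹' {b})
  have hle : ∀ a, p a ≤ q a.2 := fun a =>
    measureReal_preimage_singleton_le_comp (fun ω => (X ω, Y ω)) Prod.snd a
  have hp0 : ∀ a, 0 ≤ p a := fun a => measureReal_nonneg
  have hnn : ∀ a, 0 ≤ p a * (Real.logb 2 (q a.2) - Real.logb 2 (p a)) := by
    intro a
    rcases (hp0 a).eq_or_lt with h0 | h0
    · simp [← h0]
    · exact mul_nonneg (hp0 a)
        (sub_nonneg.2 (Real.logb_le_logb_of_le one_lt_two h0 (hle a)))
  rw [condEntH_eq_sum hX hY, Finset.sum_eq_zero_iff_of_nonneg fun a _ => hnn a] at h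
  have heq : ∀ a, p a ≠ 0 → p a = q a.2 := by
    intro a ha
    have hpos : 0 < p a := (hp0 a).lt_of_ne' ha
    have h' := (mul_eq_zero.1 (h a (Finset.mem_univ a))).resolve_left ha
    exact (Real.logb_injOn_pos one_lt_two (hpos.trans_le (hle a)) hpos (sub_eq_zero.1 h')).symm
  have huniq : ∀ x x' y, p (x, y) ≠ 0 → p (x', y) ≠ 0 → x = x' := by
    intro x x' y hx hx'
    by_contra hne
    have hsum : p (x, y) + p (x', y) ≤ q y := by
      have hmar := measureReal_comp_preimage_singleton (μ := μ) hW Prod.snd y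
      have hsub : ({(x, y), (x', y)} : Finset (α × β)) ⊆ Finset.univ.filter (fun a => a.2 = y) := by
        intro a ha
        simp only [Finset.mem_insert, Finset.mem_singleton] at ha
        rcases ha with rfl | rfl <;> simp
      have := Finset.sum_le_sum_of_subset_of_nonneg hsub fun a _ _ => hp0 a
      rw [Finset.sum_pair (by simp [hne])] at this
      exact this.trans_eq hmar.symm
    have := heq _ hx
    have h2 := (hp0 (x', y)).lt_of_ne' hx'
    simp only at this
    linarith
  obtain ⟨ω₀⟩ := μ.nonempty_of_neZero
  refine ⟨fun y => if hy : ∃ x, p (x, y) ≠ 0 then hy.choose else X ω₀, ?_⟩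
  filter_upwards [ae_measureReal_preimage_singleton_ne_zero (μ := μ) fun ω => (X ω, Y ω)]
    with ω hω
  have hy : ∃ x, p (x, Y ω) ≠ 0 := ⟨X ω, hω⟩
  rw [dif_pos hy]
  exact huniq _ _ _ hω hy.choose_spec

theorem condEntH_eq_zero_of_ae_eq [IsFiniteMeasure μ] {X : Ω → α} {Y : Ω → β}
    (hX : Measurable X) (hY : Measurable Y) (f : β → α) (h : ∀ᵐ ω ∂μ, X ω = f (Y ω)) :
    condEntH μ X Y = 0 := by
  rw [condEntH_eq_sum hX hY]
  refine Finset.sum_eq_zero fun a _ => ?_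
  by_cases ha : μ.real ((fun ω => (X ω, Y ω)) ⁻¹' {a}) = 0
  · rw [ha, zero_mul]
  · obtain ⟨ω₀, hω₀, hf⟩ := exists_mem_of_ae_of_measureReal_ne_zero ha h
    obtain rfl : (X ω₀, Y ω₀) = a := hω₀
    have : μ.real ((fun ω => (X ω, Y ω)) ⁻¹' {(X ω₀, Y ω₀)}) = μ.real (Y ⁻¹' {Y ω₀}) := by
      refine measureReal_congr ?_
      filter_upwards [h] with ω hω
      refine propext ⟨fun h' => congrArg Prod.snd h', fun h' => ?_⟩
      have h' : Y ω = Y ω₀ := h'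
      change (X ω, Y ω) = (X ω₀, Y ω₀)
      rw [hω, hf, h']
    rw [this, sub_self, mul_zero]

theorem cmiH_mul_log_two [IsFiniteMeasure μ] {X : Ω → α} {Y : Ω → β} {Z : Ω → γ}
    (hX : Measurable X) (hY : Measurable Y) (hZ : Measurable Z) :
    cmiH μ X Y Z * Real.log 2 =
      ∑ a : (α × β) × γ, μ.real ((fun ω => ((X ω, Y ω), Z ω)) ⁻¹' {a}) *
        (Real.log (μ.real ((fun ω => ((X ω, Y ω), Z ω)) ⁻¹' {a})) +
          Real.log (μ.real (Z ⁻¹' {a.2})) -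
          Real.log (μ.real ((fun ω => (X ω, Z ω)) ⁻¹' {(a.1.1, a.2)})) -
          Real.log (μ.real ((fun ω => (Y ω, Z ω)) ⁻¹' {(a.1.2, a.2)}))) := by
  have hW := (hX.prodMk hY).prodMk hZ
  have hXZ := entH_comp (μ := μ) hW fun a => (a.1.1, a.2)
  have hYZ := entH_comp (μ := μ) hW fun a => (a.1.2, a.2)
  have hZ' := entH_comp (μ := μ) hW Prod.snd
  have hXYZ := entH_comp (μ := μ) hW id
  simp only [id] at hXZ hYZ hZ' hXYZ
  have h2 : Real.log 2 ≠ 0 := (Real.log_pos one_lt_two).ne'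
  unfold cmiH condEntH
  rw [hXZ, hYZ, hZ', hXYZ]
  simp only [Real.logb, ← mul_div_assoc, ← Finset.sum_div, mul_sub, mul_add,
    Finset.sum_sub_distrib, Finset.sum_add_distrib]
  field_simp
  ring

/-- Under vanishing conditional mutual information, the joint support contains the fibre product
of the supports. -/
theorem measureReal_ne_zero_of_cmiH_eq_zero [IsFiniteMeasure μ] {X : Ω → α} {Y : Ω → β}
    {Z : Ω → γ} (hX : Measurable X) (hY : Measurable Y) (hZ : Measurable Z)
    (h : cmiH μ X Y Z = 0) {x : α} {y : β} {z : γ}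
    (hx : μ.real ((fun ω => (X ω, Z ω)) ⁻¹' {(x, z)}) ≠ 0)
    (hy : μ.real ((fun ω => (Y ω, Z ω)) ⁻¹' {(y, z)}) ≠ 0) :
    μ.real ((fun ω => ((X ω, Y ω), Z ω)) ⁻¹' {((x, y), z)}) ≠ 0 := by
  classical
  have hW := (hX.prodMk hY).prodMk hZ
  have h' := cmiH_mul_log_two (μ := μ) hX hY hZ
  rw [h, zero_mul] at h'
  set p : (α × β) × γ → ℝ := fun a => μ.real ((fun ω => ((X ω, Y ω), Z ω)) ⁻¹' {a}) with hp
  set r : α × γ → ℝ := fun a => μ.real ((fun ω => (X ω, Z ω)) ⁻¹' {a}) with hr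
  set s : β × γ → ℝ := fun a => μ.real ((fun ω => (Y ω, Z ω)) ⁻¹' {a}) with hs
  set t : γ → ℝ := fun c => μ.real (Z ⁻¹' {c})
  have hpr : ∀ a, p a ≤ r (a.1.1, a.2) := fun a =>
    measureReal_preimage_singleton_le_comp (fun ω => ((X ω, Y ω), Z ω)) (fun a => (a.1.1, a.2)) a
  have hps : ∀ a, p a ≤ s (a.1.2, a.2) := fun a =>
    measureReal_preimage_singleton_le_comp (fun ω => ((X ω, Y ω), Z ω)) (fun a => (a.1.2, a.2)) a
  have hrt : ∀ a, r a ≤ t a.2 := fun a =>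
    measureReal_preimage_singleton_le_comp (fun ω => (X ω, Z ω)) Prod.snd a
  have hp0 : ∀ a, 0 ≤ p a := fun a => measureReal_nonneg
  have hr0 : ∀ a, 0 ≤ r a := fun a => measureReal_nonneg
  have hs0 : ∀ a, 0 ≤ s a := fun a => measureReal_nonneg
  have ht0 : ∀ a, 0 ≤ t a := fun a => measureReal_nonneg
  have hne : ∀ a, p a ≠ 0 → r (a.1.1, a.2) ≠ 0 ∧ s (a.1.2, a.2) ≠ 0 ∧ t a.2 ≠ 0 := by
    intro a ha
    have hpos := (hp0 a).lt_of_ne' ha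
    have hrpos := hpos.trans_le (hpr a)
    exact ⟨hrpos.ne', (hpos.trans_le (hps a)).ne', (hrpos.trans_le (hrt _)).ne'⟩
  have hrsum : ∀ z, ∑ x, r (x, z) = t z := by
    intro z
    refine Eq.symm ((measureReal_comp_preimage_singleton (μ := μ) (hX.prodMk hZ)
      Prod.snd z).trans ?_)
    rw [Finset.sum_filter, Fintype.sum_prod_type]
    simp [hr]
  have hssum : ∀ z, ∑ y, s (y, z) = t z := by
    intro z
    refine Eq.symm ((measureReal_comp_preimage_singleton (μ := μ) (hY.prodMk hZ)
      Prod.snd z).trans ?_)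
    rw [Finset.sum_filter, Fintype.sum_prod_type]
    simp [hs]
  have hpsum : ∀ z, ∑ a, p (a, z) = t z := by
    intro z
    refine Eq.symm ((measureReal_comp_preimage_singleton (μ := μ) hW Prod.snd z).trans ?_)
    rw [Finset.sum_filter, Fintype.sum_prod_type]
    simp [hp]
  have hsum : ∑ a, p a = ∑ a : (α × β) × γ, r (a.1.1, a.2) * s (a.1.2, a.2) / t a.2 := by
    rw [Fintype.sum_prod_type_right, Fintype.sum_prod_type_right]
    refine Finset.sum_congr rfl fun z _ => ?_
    simp only [hpsum]
    rw [← Finset.sum_div, Fintype.sum_prod_type]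
    simp only
    rw [← Finset.sum_mul_sum, hrsum, hssum, mul_self_div_self]
  have hgibbs := eq_zero_of_sum_mul_log_sub_log_eq_zero (p := p)
    (q := fun a => r (a.1.1, a.2) * s (a.1.2, a.2) / t a.2) hp0
    (fun a => div_nonneg (mul_nonneg (hr0 _) (hs0 _)) (ht0 _))
    (fun a ha => by
      obtain ⟨h1, h2, h3⟩ := hne a ha
      exact div_ne_zero (mul_ne_zero h1 h2) h3)
    hsum
    (by
      rw [h']
      refine Finset.sum_congr rfl fun a _ => ?_
      by_cases ha : p a = 0
      · rw [ha, zero_mul]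
        exact (mul_eq_zero_of_left ha _).symm
      · obtain ⟨h1, h2, h3⟩ := hne a ha
        rw [Real.log_div (mul_ne_zero h1 h2) h3, Real.log_mul h1 h2]
        ring)
    (i := ((x, y), z))
  intro h0
  have htz : t z ≠ 0 := (((hr0 _).lt_of_ne' hx).trans_le (hrt (x, z))).ne'
  exact div_ne_zero (mul_ne_zero hx hy) htz (hgibbs h0)

/-- Under vanishing mutual information, the joint support is the product of the supports. -/
theorem measureReal_ne_zero_of_miH_eq_zero [IsProbabilityMeasure μ] {X : Ω → α} {Y : Ω → β}
    (hX : Measurable X) (hY : Measurable Y) (h : miH μ X Y = 0) {x : α} {y : β}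
    (hx : μ.real (X ⁻¹' {x}) ≠ 0) (hy : μ.real (Y ⁻¹' {y}) ≠ 0) :
    μ.real ((fun ω => (X ω, Y ω)) ⁻¹' {(x, y)}) ≠ 0 := by
  rw [miH_eq_cmiH_unit] at h
  have := measureReal_ne_zero_of_cmiH_eq_zero (x := x) (y := y) (z := ()) hX hY
    measurable_const h
  simp_all [Set.preimage]

end FiniteEntropy

/-- Second entropy lemma from the Z-interference-channel impossibility argument:
if `H(X₁ | U₀,U₁) = 0`, `H(X₂ | U₀,V₀,U₂,V₂) = 0`, `H(X₁ ⊕ X₂ | V₀,V₁,V₂) = 0`,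
`I(U₀,U₁,U₂; V₀,V₁,V₂) = 0` and `I(U₁; U₂ | U₀) = 0`, then `H(X₁ | U₀) = 0`.
Here `X₁, X₂` take values in `ZMod 2` and `⊕` is addition mod 2. -/
theorem stmt_11 {Ω : Type*} [MeasurableSpace Ω] (μ : Measure Ω) [IsProbabilityMeasure μ]
    {A0 A1 A2 B0 B1 B2 : Type*}
    [Fintype A0] [Fintype A1] [Fintype A2] [Fintype B0] [Fintype B1] [Fintype B2]
    [MeasurableSpace A0] [MeasurableSingletonClass A0]
    [MeasurableSpace A1] [MeasurableSingletonClass A1]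
    [MeasurableSpace A2] [MeasurableSingletonClass A2]
    [MeasurableSpace B0] [MeasurableSingletonClass B0]
    [MeasurableSpace B1] [MeasurableSingletonClass B1]
    [MeasurableSpace B2] [MeasurableSingletonClass B2]
    [MeasurableSpace (ZMod 2)] [MeasurableSingletonClass (ZMod 2)]
    (U0 : Ω → A0) (U1 : Ω → A1) (U2 : Ω → A2)
    (V0 : Ω → B0) (V1 : Ω → B1) (V2 : Ω → B2)
    (X1 X2 : Ω → ZMod 2)
    (hU0 : Measurable U0) (hU1 : Measurable U1) (hU2 : Measurable U2)
    (hV0 : Measurable V0) (hV1 : Measurable V1) (hV2 : Measurable V2)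
    (hX1 : Measurable X1) (hX2 : Measurable X2)
    (h1 : condEntH μ X1 (fun ω => (U0 ω, U1 ω)) = 0)
    (h2 : condEntH μ X2 (fun ω => (U0 ω, V0 ω, U2 ω, V2 ω)) = 0)
    (h3 : condEntH μ (fun ω => X1 ω + X2 ω) (fun ω => (V0 ω, V1 ω, V2 ω)) = 0)
    (h4 : miH μ (fun ω => (U0 ω, U1 ω, U2 ω)) (fun ω => (V0 ω, V1 ω, V2 ω)) = 0)
    (h5 : cmiH μ U1 U2 U0 = 0) :
    condEntH μ X1 U0 = 0 := by
  classical
  obtain ⟨f, hf⟩ := exists_ae_eq_of_condEntH_eq_zero hX1 (hU0.prodMk hU1) h1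
  obtain ⟨g, hg⟩ := exists_ae_eq_of_condEntH_eq_zero hX2
    (hU0.prodMk (hV0.prodMk (hU2.prodMk hV2))) h2
  obtain ⟨k, hk⟩ := exists_ae_eq_of_condEntH_eq_zero
    ((Measurable.of_discrete (f := fun x : ZMod 2 × ZMod 2 => x.1 + x.2)).comp (hX1.prodMk hX2))
    (hV0.prodMk (hV1.prodMk hV2)) h3
  have hsupp := ae_measureReal_preimage_singleton_ne_zero (μ := μ) fun ω => (U1 ω, U0 ω)
  have hU := hU0.prodMk (hU1.prodMk hU2)
  have hV := hV0.prodMk (hV1.prodMk hV2)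
  obtain ⟨ω', hω'⟩ := (ae_measureReal_preimage_singleton_ne_zero (μ := μ)
    fun ω => (V0 ω, V1 ω, V2 ω)).exists
  have hrel : ∀ u0 u1 u2, μ.real ((fun ω => (U1 ω, U0 ω)) ⁻¹' {(u1, u0)}) ≠ 0 →
      μ.real ((fun ω => (U2 ω, U0 ω)) ⁻¹' {(u2, u0)}) ≠ 0 →
      f (u0, u1) + g (u0, V0 ω', u2, V2 ω') = k (V0 ω', V1 ω', V2 ω') := by
    intro u0 u1 u2 hu1 hu2
    have hu := measureReal_ne_zero_of_cmiH_eq_zero hU1 hU2 hU0 h5 hu1 hu2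
    have hu' : μ.real ((fun ω => (U0 ω, U1 ω, U2 ω)) ⁻¹' {(u0, u1, u2)}) ≠ 0 := by
      convert hu using 2
      ext ω
      simp only [Set.mem_preimage, Set.mem_singleton_iff, Prod.mk.injEq]
      tauto
    have huv := measureReal_ne_zero_of_miH_eq_zero hU hV h4 hu' hω'
    obtain ⟨ω, hω, hfω, hgω, hkω⟩ :=
      exists_mem_of_ae_of_measureReal_ne_zero huv (hf.and (hg.and hk))
    simp only [Set.mem_preimage, Set.mem_singleton_iff, Prod.mk.injEq] at hω
    obtain ⟨⟨rfl, rfl, rfl⟩, hv0, hv1, hv2⟩ := hω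
    rw [← hv0, ← hv1, ← hv2, ← hfω, ← hgω, ← hkω]
    rfl
  have hind : ∀ᵐ ω ∂μ, ∀ u1, μ.real ((fun ω => (U1 ω, U0 ω)) ⁻¹' {(u1, U0 ω)}) ≠ 0 →
      X1 ω = f (U0 ω, u1) := by
    filter_upwards [hf, hsupp,
      ae_measureReal_preimage_singleton_ne_zero (μ := μ) fun ω => (U2 ω, U0 ω)]
      with ω hfω h1ω h2ω u1 hu1
    rw [hfω]
    exact add_right_cancel ((hrel _ _ _ h1ω h2ω).trans (hrel _ _ _ hu1 h2ω).symm)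
  refine condEntH_eq_zero_of_ae_eq hX1 hU0 (fun u0 =>
    if hu : ∃ u1, μ.real ((fun ω => (U1 ω, U0 ω)) ⁻¹' {(u1, u0)}) ≠ 0 then f (u0, hu.choose)
    else 0) ?_
  filter_upwards [hind, hsupp] with ω hω hs
  have hu : ∃ u1, μ.real ((fun ω => (U1 ω, U0 ω)) ⁻¹' {(u1, U0 ω)}) ≠ 0 := ⟨_, hs⟩
  rw [dif_pos hu]
  exact hω _ hu.choose_spec
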